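/- arXiv:2601.17878 — 3 statements merged into one kernel-verified Lean document; each statement's English description precedes it below -/
import Mathlib

section
/- There exists a constant C = C(Ω, n, s) > 0 such that for every continuously differentiable function u : ℝⁿ → ℝ with compact support contained in U one has ∫_Ω |u(x)|² dx ≤ C ( ∫_Ω |∇u(x)|² dx + ∬_Q |u(x) − u(y)|² / |x − y|^{n+2s} dx dy ). -/
open MeasureTheory

/-- Radial majorant profile. -/
noncomputable def radProf (q K : ℝ) (r : ℝ) : ℝ :=
  if r ≤ 1 then K * r ^ (2 - q) else K * r ^ (-q)

lemma radProf_integrable (n : ℕ) (hn : 1 ≤ n) (s : ℝ) (hs : s ∈ Set.Ioo (0 : ℝ) 1) (K : ℝ) :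
    Integrable (fun z : EuclideanSpace ℝ (Fin n) => radProf ((n : ℝ) + 2 * s) K ‖z‖) volume := by
  obtain ⟨h0, h1⟩ := hs
  have : Nonempty (Fin n) := ⟨⟨0, hn⟩⟩
  rw [integrable_fun_norm_addHaar volume (f := radProf ((n : ℝ) + 2 * s) K)]
  rw [finrank_euclideanSpace_fin, ← Set.Ioc_union_Ioi_eq_Ioi (zero_le_one (α := ℝ))]
  have hc : ((n - 1 : ℕ) : ℝ) = (n : ℝ) - 1 := by push_cast [hn]; ring
  refine IntegrableOn.union ?_ ?_
  · have h : IntegrableOn (fun r : ℝ => K * r ^ (1 - 2 * s)) (Set.Ioc 0 1) := by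
      refine Integrable.const_mul ?_ K
      have := intervalIntegral.intervalIntegrable_rpow' (a := 0) (b := 1)
        (show -1 < 1 - 2 * s by linarith)
      exact (intervalIntegrable_iff_integrableOn_Ioc_of_le zero_le_one).1 this
    refine h.congr_fun ?_ measurableSet_Ioc
    intro r hr
    simp only [radProf, if_pos hr.2, smul_eq_mul]
    rw [← Real.rpow_natCast, hc, mul_left_comm, ← Real.rpow_add hr.1]
    congr 2; ring
  · have h : IntegrableOn (fun r : ℝ => K * r ^ (-1 - 2 * s)) (Set.Ioi 1) := by
      refine Integrable.const_mul ?_ K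
      exact integrableOn_Ioi_rpow_of_lt (by linarith) zero_lt_one
    refine h.congr_fun ?_ measurableSet_Ioi
    intro r hr
    have hr' : (1 : ℝ) < r := hr
    simp only [radProf, if_neg (not_le.2 hr'), smul_eq_mul]
    rw [← Real.rpow_natCast, hc, mul_left_comm, ← Real.rpow_add (by linarith)]
    congr 2; ring

lemma radProf_nonneg (q K r : ℝ) (hK : 0 ≤ K) (hr : 0 ≤ r) : 0 ≤ radProf q K r := by
  unfold radProf; split_ifs <;> positivity

lemma kernel_bound (q K a r : ℝ) (hK : 0 ≤ K) (hr : 0 ≤ r) (h1 : a ^ 2 ≤ K * r ^ 2)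
    (h2 : a ^ 2 ≤ K) : a ^ 2 / r ^ q ≤ radProf q K r := by
  rcases hr.eq_or_lt with rfl | hr
  · have : a ^ 2 = 0 := le_antisymm (by simpa using h1) (sq_nonneg a)
    rw [this, zero_div]; exact radProf_nonneg _ _ _ hK le_rfl
  · unfold radProf
    split_ifs
    · rw [Real.rpow_sub hr, ← mul_div_assoc]
      gcongr
      simpa using h1
    · rw [Real.rpow_neg hr.le, ← div_eq_mul_inv]
      gcongr

lemma kernel_integrable (n : ℕ) (hn : 1 ≤ n) (s : ℝ) (hs : s ∈ Set.Ioo (0 : ℝ) 1)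
    (Ω : Set (EuclideanSpace ℝ (Fin n)))
    (hΩopen : IsOpen Ω) (hΩbdd : Bornology.IsBounded Ω)
    (u : EuclideanSpace ℝ (Fin n) → ℝ) (hu : ContDiff ℝ 1 u) (hc : HasCompactSupport u) :
    IntegrableOn (fun p : EuclideanSpace ℝ (Fin n) × EuclideanSpace ℝ (Fin n) =>
      (u p.1 - u p.2) ^ 2 / ‖p.1 - p.2‖ ^ ((n : ℝ) + 2 * s)) ((Ωᶜ ×ˢ Ωᶜ)ᶜ) := by
  obtain ⟨L, hL⟩ := hu.lipschitzWith_of_hasCompactSupport hc one_ne_zero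
  obtain ⟨M, hM⟩ := hc.exists_bound_of_continuous hu.continuous
  set K : ℝ := (L : ℝ) ^ 2 + (2 * M) ^ 2 with hKdef
  have hK : 0 ≤ K := by positivity
  have hbd : ∀ x y, (u x - u y) ^ 2 / ‖x - y‖ ^ ((n : ℝ) + 2 * s)
      ≤ radProf ((n : ℝ) + 2 * s) K ‖x - y‖ := by
    intro x y
    refine kernel_bound _ _ _ _ hK (norm_nonneg _) ?_ ?_
    · have h := hL.dist_le_mul x y
      rw [Real.dist_eq, dist_eq_norm] at h
      calc (u x - u y) ^ 2 = |u x - u y| ^ 2 := (sq_abs _).symm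
        _ ≤ (L * ‖x - y‖) ^ 2 := by gcongr
        _ = L ^ 2 * ‖x - y‖ ^ 2 := by ring
        _ ≤ K * ‖x - y‖ ^ 2 := by gcongr; rw [hKdef]; nlinarith [sq_nonneg (2 * M)]
    · have h1 := hM x
      have h2 := hM y
      have h : |u x - u y| ≤ 2 * M := (norm_sub_le (u x) (u y)).trans (by linarith)
      calc (u x - u y) ^ 2 = |u x - u y| ^ 2 := (sq_abs _).symm
        _ ≤ (2 * M) ^ 2 := by gcongr
        _ ≤ K := by rw [hKdef]; nlinarith [sq_nonneg (L : ℝ)]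
  have hg := radProf_integrable n hn s hs K
  have hf : Integrable (Ω.indicator (fun _ => (1 : ℝ))) :=
    (integrable_indicator_iff hΩopen.measurableSet).2
      (integrableOn_const hΩbdd.measure_lt_top.ne)
  have hI := hf.convolution_integrand (ContinuousLinearMap.mul ℝ ℝ) hg
  have hI2 := hI.swap
  have hm : AEStronglyMeasurable (fun p : EuclideanSpace ℝ (Fin n) × EuclideanSpace ℝ (Fin n) =>
      (u p.1 - u p.2) ^ 2 / ‖p.1 - p.2‖ ^ ((n : ℝ) + 2 * s))
      (volume.restrict ((Ωᶜ ×ˢ Ωᶜ)ᶜ)) := by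
    have := hu.continuous.measurable
    exact Measurable.aestronglyMeasurable (by fun_prop)
  have hQ : MeasurableSet ((Ωᶜ ×ˢ Ωᶜ)ᶜ : Set (EuclideanSpace ℝ (Fin n) × EuclideanSpace ℝ (Fin n))) :=
    (hΩopen.measurableSet.compl.prod hΩopen.measurableSet.compl).compl
  refine Integrable.mono' ((hI.add hI2).integrableOn (s := (Ωᶜ ×ˢ Ωᶜ)ᶜ)) hm ?_
  refine (ae_restrict_iff' hQ).2 (Filter.Eventually.of_forall ?_)
  rintro ⟨x, y⟩ hxy
  have h := hbd x y
  have hn0 := radProf_nonneg ((n : ℝ) + 2 * s) K ‖x - y‖ hK (norm_nonneg _)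
  rw [Real.norm_of_nonneg (by positivity)]
  simp only [Pi.add_apply, Function.comp, Prod.swap, ContinuousLinearMap.mul_apply',
    norm_sub_rev y x]
  by_cases hx : x ∈ Ω <;> by_cases hy : y ∈ Ω <;> simp [hx, hy] at hxy ⊢ <;> linarith

set_option maxHeartbeats 2000000 in
theorem poincare_type_inequality (n : ℕ) (hn : 1 ≤ n) (s : ℝ) (hs : s ∈ Set.Ioo (0 : ℝ) 1)
    (Ω 𝒩 : Set (EuclideanSpace ℝ (Fin n)))
    (hΩne : Ω.Nonempty) (hΩopen : IsOpen Ω) (hΩbdd : Bornology.IsBounded Ω)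
    (h𝒩open : IsOpen 𝒩) (h𝒩sub : 𝒩 ⊆ (closure Ω)ᶜ)
    (hUbdd : Bornology.IsBounded (Ω ∪ 𝒩)) :
    ∃ C : ℝ, 0 < C ∧
      ∀ u : EuclideanSpace ℝ (Fin n) → ℝ,
        ContDiff ℝ 1 u → HasCompactSupport u →
        tsupport u ⊆ Ω ∪ 𝒩 ∪ (frontier Ω ∩ closure 𝒩) →
        ∫ x in Ω, (u x) ^ 2 ≤
          C * ((∫ x in Ω, ‖gradient u x‖ ^ 2) +
            ∫ p in ((Ωᶜ ×ˢ Ωᶜ)ᶜ :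
                Set (EuclideanSpace ℝ (Fin n) × EuclideanSpace ℝ (Fin n))),
              (u p.1 - u p.2) ^ 2 / ‖p.1 - p.2‖ ^ ((n : ℝ) + 2 * s)) := by
  have : Nonempty (Fin n) := ⟨⟨0, hn⟩⟩
  obtain ⟨R, hR0, hR⟩ := hUbdd.subset_closedBall_lt 0 0
  obtain ⟨c, hcn⟩ := exists_norm_eq (EuclideanSpace ℝ (Fin n)) (show 0 ≤ R + 1 by linarith)
  have hΩR : Ω ⊆ Metric.closedBall 0 R := Set.subset_union_left.trans hR
  set A := Metric.ball c 1 with hA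
  have hAn : ∀ y ∈ A, R < ‖y‖ ∧ ‖y‖ < R + 2 := by
    intro y hy
    rw [hA, mem_ball_iff_norm] at hy
    have h1 := norm_sub_norm_le c y
    have h2 := norm_sub_norm_le y c
    rw [norm_sub_rev] at h1
    constructor <;> linarith
  set v := volume.real A with hv
  have hvpos : 0 < v :=
    ENNReal.toReal_pos (Metric.measure_ball_pos volume c one_pos).ne' measure_ball_lt_top.ne
  set D : ℝ := (2 * R + 2) ^ ((n : ℝ) + 2 * s) with hD
  have hDpos : 0 < D := Real.rpow_pos_of_pos (by linarith) _
  refine ⟨D / v, by positivity, fun u hu hc hsupp => ?_⟩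
  have hΩm := hΩopen.measurableSet
  have hAm : MeasurableSet A := measurableSet_ball
  have hu0 : ∀ y ∈ A, u y = 0 := by
    intro y hy
    by_contra hne
    have hy' := hsupp (subset_tsupport u hne)
    have : y ∈ Metric.closedBall (0 : EuclideanSpace ℝ (Fin n)) R := by
      rcases hy' with h | h
      · exact hR h
      · exact closure_minimal hΩR Metric.isClosed_closedBall (frontier_subset_closure h.1)
    rw [mem_closedBall_zero_iff] at this
    linarith [(hAn y hy).1]
  have hint := kernel_integrable n hn s hs Ω hΩopen hΩbdd u hu hc
  have hsub : Ω ×ˢ A ⊆ ((Ωᶜ ×ˢ Ωᶜ)ᶜ :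
      Set (EuclideanSpace ℝ (Fin n) × EuclideanSpace ℝ (Fin n))) := by
    rintro ⟨x, y⟩ ⟨hx, -⟩ ⟨hx', -⟩
    exact hx' hx
  have hcs : HasCompactSupport (fun x => (u x) ^ 2) :=
    hc.comp_left (g := fun t : ℝ => t ^ 2) (by simp)
  have hcont : Continuous (fun x => (u x) ^ 2) := hu.continuous.pow 2
  have hu2 : Integrable (fun x => (u x) ^ 2) := hcont.integrable_of_hasCompactSupport hcs
  have hprod : ∫ p in Ω ×ˢ A, (u p.1) ^ 2 * (1 / D) = (∫ x in Ω, (u x) ^ 2) * (v / D) := by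
    rw [Measure.volume_eq_prod,
      setIntegral_prod_mul (fun x => (u x) ^ 2) (fun _ => 1 / D) Ω A]
    simp [hv, div_eq_mul_inv]
  have hle1 : ∫ p in Ω ×ˢ A, (u p.1) ^ 2 * (1 / D) ≤
      ∫ p in Ω ×ˢ A, (u p.1 - u p.2) ^ 2 / ‖p.1 - p.2‖ ^ ((n : ℝ) + 2 * s) := by
    refine setIntegral_mono_on ?_ (hint.mono_set hsub) (hΩm.prod hAm) ?_
    · rw [IntegrableOn, Measure.volume_eq_prod, ← Measure.prod_restrict]
      exact hu2.integrableOn.mul_prod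
        (integrableOn_const (measure_ball_lt_top (μ := volume) (x := c) (r := 1)).ne)
    · rintro ⟨x, y⟩ ⟨hx, hy⟩
      have hx1 : ‖x‖ ≤ R := by simpa using hΩR hx
      obtain ⟨hy1, hy2⟩ := hAn y hy
      have hpos : 0 < ‖x - y‖ := by
        have := norm_sub_norm_le y x
        rw [norm_sub_rev] at this
        linarith
      have hle : ‖x - y‖ ≤ 2 * R + 2 := (norm_sub_le x y).trans (by linarith)
      simp only [hu0 y hy, sub_zero, mul_one_div]
      have h0 : 0 ≤ (n : ℝ) + 2 * s := by have := hs.1; positivity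
      have hr : ‖x - y‖ ^ ((n : ℝ) + 2 * s) ≤ D := Real.rpow_le_rpow hpos.le hle h0
      have : 0 < ‖x - y‖ ^ ((n : ℝ) + 2 * s) := Real.rpow_pos_of_pos hpos _
      gcongr
  have hle2 : ∫ p in Ω ×ˢ A, (u p.1 - u p.2) ^ 2 / ‖p.1 - p.2‖ ^ ((n : ℝ) + 2 * s) ≤
      ∫ p in ((Ωᶜ ×ˢ Ωᶜ)ᶜ : Set (EuclideanSpace ℝ (Fin n) × EuclideanSpace ℝ (Fin n))),
        (u p.1 - u p.2) ^ 2 / ‖p.1 - p.2‖ ^ ((n : ℝ) + 2 * s) :=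
    setIntegral_mono_set hint
      (Filter.Eventually.of_forall fun p => by
        simp only [Pi.zero_apply]; positivity) (Filter.Eventually.of_forall hsub)
  have hgr : 0 ≤ ∫ x in Ω, ‖gradient u x‖ ^ 2 := integral_nonneg fun x => by positivity
  have key := (hprod ▸ hle1).trans hle2
  calc ∫ x in Ω, (u x) ^ 2 = D / v * ((∫ x in Ω, (u x) ^ 2) * (v / D)) := by
        field_simp
    _ ≤ _ := by
        refine mul_le_mul_of_nonneg_left ?_ (by positivity)
        linarith
end

section
/- Assume in addition that T has dense range. Under the eigen-sequence hypotheses, the sequence {T e_k}_{k≥1} is an orthonormal Hilbert basis of L: it is orthonormal in L and the closure of its linear span equals L. -/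
open RealInnerProductSpace

/-- If moreover `T` has dense range, then under the eigen-sequence hypotheses the sequence
`{T eₖ}` is an orthonormal Hilbert basis of `L`: it is orthonormal and the closure of its
linear span is all of `L`. -/
theorem image_eigenfunctions_orthonormal_basis
    {H L : Type*} [NormedAddCommGroup H] [InnerProductSpace ℝ H] [CompleteSpace H]
    [NormedAddCommGroup L] [InnerProductSpace ℝ L] [CompleteSpace L]
    (T : H →L[ℝ] L) (hTinj : Function.Injective T) (hTcpt : IsCompactOperator T)
    (hTrange : DenseRange T)
    (lam : ℕ → ℝ) (e : ℕ → H)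
    (h1 : ∀ k, ‖T (e k)‖ = 1)
    (h2 : ∀ j k, j ≠ k → ⟪e j, e k⟫ = 0)
    (h3 : ∀ k, ∀ φ : H, ⟪e k, φ⟫ = lam k * ⟪T (e k), T φ⟫)
    (h4 : ∀ k, IsLeast
      {r : ℝ | ∃ u : H, ‖T u‖ = 1 ∧ (∀ j < k, ⟪u, e j⟫ = 0) ∧ r = ‖u‖ ^ 2} (lam k)) :
    Orthonormal ℝ (fun k : ℕ => T (e k)) ∧
    (Submodule.span ℝ (Set.range fun k : ℕ => T (e k))).topologicalClosure = ⊤ := by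
  have hlam : ∀ k, lam k = ‖e k‖ ^ 2 := by
    intro k
    have h := h3 k (e k)
    rw [real_inner_self_eq_norm_sq, real_inner_self_eq_norm_sq, h1 k] at h
    linarith
  have hpos : ∀ k, lam k ≠ 0 := by
    intro k h
    rw [hlam k] at h
    have h0 : e k = 0 := by simpa using h
    have := h1 k
    simp [h0] at this
  have hon : Orthonormal ℝ (fun k : ℕ => T (e k)) := by
    refine ⟨h1, fun j k hjk => ?_⟩
    have h := h3 j (e k)
    rw [h2 j k hjk] at h
    exact (mul_eq_zero.mp h.symm).resolve_left (hpos j)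
  refine ⟨hon, ?_⟩
  -- the span of the eigenfunctions has trivial orthogonal complement in `H`
  have hperp : (Submodule.span ℝ (Set.range e))ᗮ = ⊥ := by
    rw [Submodule.eq_bot_iff]
    intro u hu
    by_contra hu0
    have hTu : ‖T u‖ ≠ 0 := by
      rw [norm_ne_zero_iff]
      intro h
      exact hu0 (hTinj (by rw [h, map_zero]))
    have huj : ∀ j, ⟪u, e j⟫ = 0 := fun j =>
      Submodule.inner_left_of_mem_orthogonal (Submodule.subset_span (Set.mem_range_self j)) hu
    have hbd : ∀ k, ‖e k‖ ≤ ‖(‖T u‖⁻¹ • u)‖ := by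
      intro k
      have h := (h4 k).2 ⟨‖T u‖⁻¹ • u, by
        rw [map_smul, norm_smul, norm_inv, norm_norm, inv_mul_cancel₀ hTu], fun j _ => by
        rw [real_inner_smul_left, huj j, mul_zero], rfl⟩
      rw [hlam k] at h
      exact (sq_le_sq₀ (norm_nonneg _) (norm_nonneg _)).mp h
    obtain ⟨a, -, φ, hφ, hlim⟩ :=
      (hTcpt.isCompact_closure_image_closedBall ‖(‖T u‖⁻¹ • u)‖).tendsto_subseq
        (x := fun k => T (e k)) (fun k => subset_closure
          ⟨e k, by simpa using hbd k, rfl⟩)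
    obtain ⟨N, hN⟩ := Metric.cauchySeq_iff.mp hlim.cauchySeq 1 one_pos
    have hd := hN N le_rfl (N + 1) (Nat.le_succ N)
    have hne : φ N ≠ φ (N + 1) := (hφ (Nat.lt_succ_self N)).ne
    simp only [Function.comp, dist_eq_norm] at hd
    have hsq := @norm_sub_sq_real L _ _ (T (e (φ N))) (T (e (φ (N + 1))))
    have h0 : ⟪T (e (φ N)), T (e (φ (N + 1)))⟫ = 0 := hon.2 hne
    rw [h0, h1, h1] at hsq
    nlinarith [norm_nonneg (T (e (φ N)) - T (e (φ (N + 1))))]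
  rw [Submodule.topologicalClosure_eq_top_iff, Submodule.eq_bot_iff]
  intro y hy
  -- the adjoint of `T` kills `y`
  have hadj : T.adjoint y = 0 := by
    have hmem : T.adjoint y ∈ (Submodule.span ℝ (Set.range e))ᗮ := by
      rw [Submodule.mem_orthogonal]
      intro v hv
      rw [ContinuousLinearMap.adjoint_inner_right]
      refine (Submodule.mem_orthogonal _ _).mp hy _ ?_
      have := Submodule.mem_map_of_mem (f := (T : H →ₗ[ℝ] L)) hv
      rw [Submodule.map_span, ← Set.range_comp] at this
      exact this
    rw [hperp] at hmem
    simpa using hmem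
  refine hTrange.eq_zero_of_inner_left (𝕜 := ℝ) ?_
  intro x
  rw [← ContinuousLinearMap.adjoint_inner_left, hadj, inner_zero_left]
end

section
/- Under the eigen-sequence hypotheses, the sequence {e_k}_{k≥1} is an orthogonal basis of H: the e_k are pairwise orthogonal in H, and if w ∈ H satisfies ⟨w, e_k⟩_H = 0 for every k ≥ 1, then w = 0; equivalently, the closure of the linear span of {e_k : k ≥ 1} equals H. -/
open RealInnerProductSpace

/-- Under the eigen-sequence hypotheses, `{eₖ}` is an orthogonal basis of `H`: the `eₖ`
are pairwise orthogonal, any `w ∈ H` orthogonal to all `eₖ` vanishes, and the closure of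
the linear span of the `eₖ` is all of `H`. -/
theorem eigenfunctions_orthogonal_basis
    {H L : Type*} [NormedAddCommGroup H] [InnerProductSpace ℝ H] [CompleteSpace H]
    [NormedAddCommGroup L] [InnerProductSpace ℝ L] [CompleteSpace L]
    (T : H →L[ℝ] L) (hTinj : Function.Injective T) (hTcpt : IsCompactOperator T)
    (lam : ℕ → ℝ) (e : ℕ → H)
    (h1 : ∀ k, ‖T (e k)‖ = 1)
    (h2 : ∀ j k, j ≠ k → ⟪e j, e k⟫ = 0)
    (h3 : ∀ k, ∀ φ : H, ⟪e k, φ⟫ = lam k * ⟪T (e k), T φ⟫)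
    (h4 : ∀ k, IsLeast
      {r : ℝ | ∃ u : H, ‖T u‖ = 1 ∧ (∀ j < k, ⟪u, e j⟫ = 0) ∧ r = ‖u‖ ^ 2} (lam k)) :
    (∀ j k, j ≠ k → ⟪e j, e k⟫ = 0) ∧
    (∀ w : H, (∀ k, ⟪w, e k⟫ = 0) → w = 0) ∧
    (Submodule.span ℝ (Set.range e)).topologicalClosure = ⊤ := by
  have hw : ∀ w : H, (∀ k, ⟪w, e k⟫ = 0) → w = 0 := by
    intro w hw
    by_contra hne
    have hTw : ‖T w‖ ≠ 0 := by
      intro h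
      apply hne
      apply hTinj
      rw [map_zero]
      exact norm_eq_zero.mp h
    have hnorm : ∀ k, ‖e k‖ ^ 2 = lam k := by
      intro k
      have h := h3 k (e k)
      rw [real_inner_self_eq_norm_sq, real_inner_self_eq_norm_sq, h1 k] at h
      simpa using h
    have hne0 : ∀ k, lam k ≠ 0 := by
      intro k h0
      have h := hnorm k
      rw [h0] at h
      have h' : e k = 0 := by simpa using h
      have h'' := h1 k
      rw [h'] at h''
      simp at h''
    have horth : ∀ j k, j ≠ k → ⟪T (e j), T (e k)⟫ = 0 := by
      intro j k hjk
      have h := h3 j (e k)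
      rw [h2 j k hjk] at h
      exact (mul_eq_zero.mp h.symm).resolve_left (hne0 j)
    set u : H := (‖T w‖⁻¹) • w with hu
    have hbound : ∀ k, ‖e k‖ ≤ ‖u‖ := by
      intro k
      have h := (h4 k).2 ⟨u, ?_, ?_, rfl⟩
      · rw [← hnorm k] at h
        exact le_of_sq_le_sq h (norm_nonneg _)
      · rw [hu, map_smul, norm_smul, norm_inv, norm_norm, inv_mul_cancel₀ hTw]
      · intro j _
        rw [hu, real_inner_smul_left, hw j, mul_zero]
    have hK := hTcpt.isCompact_closure_image_closedBall ‖u‖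
    obtain ⟨a, _, f, hf, hlim⟩ := hK.tendsto_subseq (x := fun k => T (e k))
      (fun k => subset_closure ⟨e k, by simpa using hbound k, rfl⟩)
    have hc := hlim.cauchySeq
    obtain ⟨N, hN⟩ := Metric.cauchySeq_iff.mp hc 1 one_pos
    have hd := hN N le_rfl (N + 1) (Nat.le_succ N)
    simp only [Function.comp] at hd
    rw [dist_eq_norm] at hd
    have hs := norm_sub_sq_real (T (e (f N))) (T (e (f (N + 1))))
    rw [horth _ _ (hf (Nat.lt_succ_self N)).ne, h1, h1] at hs
    nlinarith [norm_nonneg (T (e (f N)) - T (e (f (N + 1))))]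
  refine ⟨h2, hw, ?_⟩
  rw [Submodule.topologicalClosure_eq_top_iff, Submodule.eq_bot_iff]
  intro w hwm
  apply hw
  intro k
  exact Submodule.inner_left_of_mem_orthogonal (Submodule.subset_span (Set.mem_range_self k)) hwm
end
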